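/- Let G be a nonempty position. Then v(G) > 2 if and only if either c(G) > 2, or both of the following hold: (i) either θ(G) = 1 and size(G) ≡ 3 (mod 4), or θ(G) = 0 and size(G) ≢ 2 (mod 4); and (ii) either c(G) + 4·f(G) > 2 and c(G) ≡ 3, −3, or 4 (mod 8), or c(G) + 4·f(G) < 2 and f(G) is even. -/

import Mathlib

namespace DotsAndBoxes

/-- A component of a Dots & Boxes endgame position: an `n`-chain or an `n`-loop. -/
inductive Component : Type where
  | chain (n : ℕ)
  | loop (n : ℕ)
deriving DecidableEq

namespace Component

/-- The number of boxes in a component. -/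
def size : Component → ℕ
  | chain n => n
  | loop n => n

def isChain : Component → Bool
  | chain _ => true
  | loop _ => false

def isLoop : Component → Bool
  | chain _ => false
  | loop _ => true

/-- A chain must have length at least 3; a loop must have even length at least 4. -/
def Valid : Component → Prop
  | chain n => 3 ≤ n
  | loop n => 4 ≤ n ∧ Even n

end Component

/-- A position is a finite multiset of components. -/
abbrev Position := Multiset Component

def Position.Valid (G : Position) : Prop := ∀ C ∈ G, C.Valid

/-- The number of unclaimed boxes in a position. -/
def size (G : Position) : ℕ := (G.map Component.size).sum

/-- The number of chains of a position. -/
def numChains (G : Position) : ℕ := Multiset.card (G.filter fun C => C.isChain = true)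

/-- The number of loops of a position. -/
def numLoops (G : Position) : ℕ := Multiset.card (G.filter fun C => C.isLoop = true)

/-- θ(G), the number of 3-chains. -/
def theta (G : Position) : ℕ := G.count (Component.chain 3)

/-- f(G), the number of 4-loops. -/
def numF (G : Position) : ℕ := G.count (Component.loop 4)

/-- s(G), the number of 6-loops. -/
def numS (G : Position) : ℕ := G.count (Component.loop 6)

open Classical in
/-- The terminal bonus tb(G). -/
noncomputable def tb (G : Position) : ℤ :=
  if G = 0 then 0
  else if ∀ C ∈ G, C.isLoop = true then 8
  else if (∃ C ∈ G, C.isLoop = true) ∧ Component.chain 3 ∈ G ∧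
      (∀ C ∈ G, C.isChain = true → C = Component.chain 3) then 6
  else 4

/-- The controlled value c(G). -/
noncomputable def cval (G : Position) : ℤ :=
  (size G : ℤ) - 4 * (numChains G : ℤ) - 8 * (numLoops G : ℤ) + tb G

/-- The score v(G;C) of opening component `C`, given that the remainder of the
position has value `w`. -/
def openVal (C : Component) (w : ℤ) : ℤ :=
  match C with
  | Component.chain n => ((n : ℤ) - 2) + |w - 2|
  | Component.loop n => ((n : ℤ) - 4) + |w - 4|

/-- Auxiliary recursion (on the number of components) for the value `v`. -/
noncomputable def valueAux : ℕ → Position → ℤ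
  | 0, _ => 0
  | n + 1, G =>
    if G = 0 then 0
    else sInf { x : ℤ | ∃ C ∈ G, x = openVal C (valueAux n (G.erase C)) }

/-- The value v(G): v(∅) = 0, and v(G) = min over components C of G of v(G;C). -/
noncomputable def value (G : Position) : ℤ := valueAux (Multiset.card G) G

/-- v(G;C), the value of G given that the opener has just opened C. -/
noncomputable def valueOpen (G : Position) (C : Component) : ℤ :=
  openVal C (value (G.erase C))

/-- Opening a component C of G is optimal if C ∈ G and v(G;C) = v(G). -/
def Optimal (G : Position) (C : Component) : Prop :=
  C ∈ G ∧ valueOpen G C = value G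



/-- Terminal bonus from statistics: `t` 3-chains, `m` other chains, `l` loops. -/
def tbS (t m l : ℕ) : ℤ :=
  if t = 0 ∧ m = 0 then (if l = 0 then 0 else 8) else if m = 0 ∧ l ≠ 0 then 6 else 4

/-- Controlled value from statistics. -/
def cS (t m f L x : ℕ) : ℤ := (x : ℤ) - 4 * (t + m) - 8 * (f + L) + tbS t m (f + L)

/-- The condition (ii). -/
def goodS (c : ℤ) (f : ℕ) : Prop :=
  (2 < c + 4 * f ∧ (c % 8 = 3 ∨ c % 8 = 5 ∨ c % 8 = 4)) ∨ (c + 4 * f < 2 ∧ f % 2 = 0)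

instance (c : ℤ) (f : ℕ) : Decidable (goodS c f) := by unfold goodS; infer_instance

/-- The value formula for nonempty positions with controlled value `c`. -/
def vc (c : ℤ) (t m f L x : ℕ) : ℤ :=
  if 2 ≤ c then c
  else if t = 0 then
    (if x % 4 = 2 then 2 else if goodS c f then 4 - (x % 2 : ℕ) else (x % 2 : ℕ))
  else if t = 1 ∧ x % 4 = 3 then (if goodS c f then 3 else 1)
  else if x % 2 = 1 then 1
  else if c = 0 ∧ 1 ≤ f ∧ ¬ (t = 2 ∧ m = 0 ∧ f = 1 ∧ L = 0) then 0
  else 2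

/-- The closed formula for the value. -/
def vS (t m f L x : ℕ) : ℤ :=
  if t + m + f + L = 0 then 0 else vc (cS t m f L x) t m f L x

/-- Constraints satisfied by the statistics of valid positions. -/
def feas (t m f L x : ℕ) : Prop :=
  3 * t + 4 * m + 4 * f + 6 * L ≤ x ∧ (m = 0 → (x + t) % 2 = 0) ∧
    (m = 0 → L = 0 → x = 3 * t + 4 * f)

theorem vS_empty (x : ℕ) : vS 0 0 0 0 x = 0 := by simp [vS]

theorem vS_ne {t m f L x : ℕ} (h : 0 < t + m + f + L) :
    vS t m f L x = vc (cS t m f L x) t m f L x := by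
  unfold vS; rw [if_neg (by omega)]

theorem vc_two (c : ℤ) {t m f L x : ℕ} (ht : t = 0) (hx : x % 4 = 2) :
    vc c t m f L x = if 2 ≤ c then c else 2 := by
  simp [vc, ht, hx]

theorem vc_zero (c : ℤ) {t m f L x : ℕ} (ht : t = 0) (hx : x % 4 = 0) :
    vc c t m f L x = if 2 ≤ c then c else if goodS c f then 4 else 0 := by
  have : x % 2 = 0 := by omega
  simp [vc, ht, hx, this]

theorem vc_odd (c : ℤ) {t m f L x : ℕ} (h : x % 2 = 1) (ht : t = 0 ∨ (t = 1 ∧ x % 4 = 3)) :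
    vc c t m f L x = if 2 ≤ c then c else if goodS c f then 3 else 1 := by
  have : x % 4 ≠ 2 := by omega
  rcases ht with ht | ⟨ht, h'⟩
  · simp [vc, ht, h, this]
  · simp [vc, ht, h']

theorem vc_one (c : ℤ) {t m f L x : ℕ} (h : x % 2 = 1) (ht : 2 ≤ t ∨ (t = 1 ∧ x % 4 = 1)) :
    vc c t m f L x = if 2 ≤ c then c else 1 := by
  have h1 : t ≠ 0 := by omega
  have h2 : ¬ (t = 1 ∧ x % 4 = 3) := by omega
  simp [vc, h1, h, h2]

theorem vc_even (c : ℤ) {t m f L x : ℕ} (h : x % 2 = 0) (ht : 1 ≤ t) :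
    vc c t m f L x = if 2 ≤ c then c else
      if c = 0 ∧ 1 ≤ f ∧ ¬ (t = 2 ∧ m = 0 ∧ f = 1 ∧ L = 0) then 0 else 2 := by
  have h1 : t ≠ 0 := by omega
  have h2 : ¬ (t = 1 ∧ x % 4 = 3) := by omega
  have h3 : ¬ (x % 2 = 1) := by omega
  unfold vc
  rw [if_neg h1, if_neg h2, if_neg h3]

/-- All the possibilities for the terminal bonus. -/
theorem tbS_cases (t m l : ℕ) :
    (t = 0 ∧ m = 0 ∧ l = 0 ∧ tbS t m l = 0) ∨ (t = 0 ∧ m = 0 ∧ 0 < l ∧ tbS t m l = 8) ∨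
    (0 < t ∧ m = 0 ∧ 0 < l ∧ tbS t m l = 6) ∨ (0 < t ∧ m = 0 ∧ l = 0 ∧ tbS t m l = 4) ∨
    (0 < m ∧ tbS t m l = 4) := by
  unfold tbS; split_ifs <;> omega

theorem vc_bounds (c : ℤ) (t m f L x : ℕ) (h : (c - x) % 2 = 0) :
    c ≤ vc c t m f L x ∧ 0 ≤ vc c t m f L x ∧ vc c t m f L x ≤ max c 4 ∧
    (0 < t → vc c t m f L x ≤ max c 3) := by
  have : x % 2 < 2 := Nat.mod_lt _ (by norm_num)
  unfold vc; split_ifs <;> omega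

theorem vc_parity (c : ℤ) (t m f L x : ℕ) (h : (c - x) % 2 = 0) :
    (vc c t m f L x - x) % 2 = 0 := by
  unfold vc; split_ifs <;> omega

set_option maxHeartbeats 4000000 in
theorem low_loop4 (t m f L x : ℕ) (h : feas t m f L x) :
    vS t m (f+1) L (x+4) ≤ |vS t m f L x - 4| := by
  obtain ⟨h1, h2, h3⟩ := h
  apply le_abs.mpr
  rcases Nat.eq_zero_or_pos (t + m + f + L) with h0 | h0
  · obtain ⟨rfl, rfl, rfl, rfl⟩ : t = 0 ∧ m = 0 ∧ f = 0 ∧ L = 0 := by omega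
    obtain rfl : x = 0 := by omega
    decide
  rw [vS_ne h0, vS_ne (by omega)]
  obtain ⟨c, hc⟩ : ∃ c, c = cS t m f L x := ⟨_, rfl⟩
  obtain ⟨d, hd⟩ : ∃ c, c = cS t m (f+1) L (x+4) := ⟨_, rfl⟩
  rw [← hc, ← hd]
  unfold cS at hc hd
  have k : (m = 0 ∧ f + L = 0 ∧ c = 4 - t ∧ d = 2 - t ∧ 0 < t) ∨ (d = c - 4 ∧ 
     ((c - x) % 4 = 0 ∨ (0 < t ∧ m = 0 ∧ (c-x)%4 = 2)) ∧ -(t + 4*f+2*L : ℤ) + 4 ≤ c ∧ (0 < m ∨ 0 < f + L)) := by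
    rcases tbS_cases t m (f+L) with h | h | h | h | h <;> 
    rcases tbS_cases t m (f+1+L) with h' | h' | h' | h' | h' <;> omega
  clear hc hd
  have hx : x % 4 = 0 ∨ x % 4 = 1 ∨ x % 4 = 2 ∨ x % 4 = 3 := by omega
  have hx' : (x+4) % 4 = x % 4 := by omega
  rcases Nat.lt_or_ge t 1 with ht | ht
  · rcases hx with hx | hx | hx | hx
    · rw [vc_zero c (by omega) hx, vc_zero d (by omega) (by omega)]
      unfold goodS; split_ifs <;> omega
    · rw [vc_odd c (by omega) (by omega), vc_odd d (by omega) (by omega)]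
      unfold goodS; split_ifs <;> omega
    · rw [vc_two c (by omega) hx, vc_two d (by omega) (by omega)]
      split_ifs <;> omega
    · rw [vc_odd c (by omega) (by omega), vc_odd d (by omega) (by omega)]
      unfold goodS; split_ifs <;> omega
  rcases Nat.mod_two_eq_zero_or_one x with h5 | h5
  · rw [vc_even c (by omega) (by omega), vc_even d (by omega) (by omega)]
    split_ifs <;> omega
  by_cases h6 : t = 1 ∧ x % 4 = 3
  · rw [vc_odd c (by omega) (by omega), vc_odd d (by omega) (by omega)]
    unfold goodS; split_ifs <;> omega
  · rw [vc_one c (by omega) (by omega), vc_one d (by omega) (by omega)]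
    split_ifs <;> omega

set_option maxHeartbeats 4000000 in
theorem low_chain3 (t m f L x : ℕ) (h : feas t m f L x) :
    vS (t+1) m f L (x+3) ≤ 1 + |vS t m f L x - 2| := by
  obtain ⟨h1, h2, h3⟩ := h
  rw [← sub_le_iff_le_add']
  apply le_abs.mpr
  rcases Nat.eq_zero_or_pos (t + m + f + L) with h0 | h0
  · obtain ⟨rfl, rfl, rfl, rfl⟩ : t = 0 ∧ m = 0 ∧ f = 0 ∧ L = 0 := by omega
    obtain rfl : x = 0 := by omega
    decide
  rw [vS_ne h0, vS_ne (by omega)]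
  obtain ⟨c, hc⟩ : ∃ c, c = cS t m f L x := ⟨_, rfl⟩
  obtain ⟨d, hd⟩ : ∃ c, c = cS (t+1) m f L (x+3) := ⟨_, rfl⟩
  rw [← hc, ← hd]
  unfold cS at hc hd
  have k : (t = 0 ∧ m = 0 ∧ d = c - 3 ∧ (c - x) % 4 = 0) ∨ (d = c - 1 ∧ 
     ((c - x) % 4 = 0 ∨ (0 < t ∧ m = 0 ∧ (c-x)%4 = 2)) ∧ -(t + 4*f+2*L : ℤ) + 4 ≤ c) := by
    rcases tbS_cases t m (f+L) with h | h | h | h | h <;> 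
    rcases tbS_cases (t+1) m (f+L) with h' | h' | h' | h' | h' <;> omega
  clear hc hd
  have hx : x % 4 = 0 ∨ x % 4 = 1 ∨ x % 4 = 2 ∨ x % 4 = 3 := by omega
  rcases Nat.lt_or_ge t 1 with ht | ht
  · rcases hx with hx | hx | hx | hx
    · rw [vc_zero c (by omega) hx, vc_odd d (by omega) (by omega)]
      unfold goodS; split_ifs <;> omega
    · rw [vc_odd c (by omega) (by omega), vc_even d (by omega) (by omega)]
      unfold goodS; split_ifs <;> omega
    · rw [vc_two c (by omega) hx, vc_one d (by omega) (by omega)]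
      split_ifs <;> omega
    · rw [vc_odd c (by omega) (by omega), vc_even d (by omega) (by omega)]
      unfold goodS; split_ifs <;> omega
  rcases Nat.mod_two_eq_zero_or_one x with h5 | h5
  · rw [vc_even c (by omega) (by omega), vc_one d (by omega) (by omega)]
    split_ifs <;> omega
  by_cases h6 : t = 1 ∧ x % 4 = 3
  · rw [vc_odd c (by omega) (by omega), vc_even d (by omega) (by omega)]
    unfold goodS; split_ifs <;> omega
  · rw [vc_one c (by omega) (by omega), vc_even d (by omega) (by omega)]
    split_ifs <;> omega

set_option maxHeartbeats 4000000 in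
theorem low_chain (n t m f L x : ℕ) (h : feas t m f L x) (hn : 4 ≤ n) :
    vS t (m+1) f L (x+n) ≤ ((n : ℤ) - 2) + |vS t m f L x - 2| := by
  obtain ⟨h1, h2, h3⟩ := h
  rw [← sub_le_iff_le_add']
  apply le_abs.mpr
  rcases Nat.eq_zero_or_pos (t + m + f + L) with h0 | h0
  · obtain ⟨rfl, rfl, rfl, rfl⟩ : t = 0 ∧ m = 0 ∧ f = 0 ∧ L = 0 := by omega
    obtain rfl : x = 0 := by omega
    rw [vS_empty, vS_ne (by omega)]
    have hc : cS 0 (0+1) 0 0 (0+n) = n := by simp [cS, tbS]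
    rw [hc, vc, if_pos (by omega)]
    omega
  rw [vS_ne h0, vS_ne (by omega)]
  obtain ⟨c, hc⟩ : ∃ c, c = cS t m f L x := ⟨_, rfl⟩
  obtain ⟨d, hd⟩ : ∃ c, c = cS t (m+1) f L (x+n) := ⟨_, rfl⟩
  rw [← hc, ← hd]
  unfold cS at hc hd
  have k : ((m = 0 ∧ 0 < f + L ∧ t = 0 ∧ d = c + n - 8 ∧ (c - x) % 4 = 0) ∨
     (m = 0 ∧ 0 < f + L ∧ 0 < t ∧ d = c + n - 6 ∧ (c - x) % 4 = 2) ∨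
     ((0 < m ∨ f + L = 0) ∧ d = c + n - 4 ∧ (c - x) % 4 = 0)) ∧
     -(t + 4*f+2*L : ℤ) + 4 ≤ c := by
    rcases tbS_cases t m (f+L) with h | h | h | h | h <;>
    rcases tbS_cases t (m+1) (f+L) with h' | h' | h' | h' | h' <;> omega
  clear hc hd
  rcases Nat.lt_or_ge 4 n with hn' | hn'
  · have b1 := vc_bounds c t m f L x (by omega)
    have b2 := vc_bounds d t (m+1) f L (x+n) (by omega)
    have p1 := vc_parity c t m f L x (by omega)
    have p2 := vc_parity d t (m+1) f L (x+n) (by omega)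
    generalize vc c t m f L x = v at *
    by_cases hd2 : 2 ≤ d
    · rw [vc, if_pos hd2]
      omega
    · generalize vc d t (m+1) f L (x+n) = w at *
      omega
  obtain rfl : n = 4 := by omega
  have hx : x % 4 = 0 ∨ x % 4 = 1 ∨ x % 4 = 2 ∨ x % 4 = 3 := by omega
  have hx' : (x+4) % 4 = x % 4 := by omega
  rcases Nat.lt_or_ge t 1 with ht | ht
  · rcases hx with hx | hx | hx | hx
    · rw [vc_zero c (by omega) hx, vc_zero d (by omega) (by omega)]
      unfold goodS; split_ifs <;> omega
    · rw [vc_odd c (by omega) (by omega), vc_odd d (by omega) (by omega)]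
      unfold goodS; split_ifs <;> omega
    · rw [vc_two c (by omega) hx, vc_two d (by omega) (by omega)]
      split_ifs <;> omega
    · rw [vc_odd c (by omega) (by omega), vc_odd d (by omega) (by omega)]
      unfold goodS; split_ifs <;> omega
  rcases Nat.mod_two_eq_zero_or_one x with h5 | h5
  · rw [vc_even c (by omega) (by omega), vc_even d (by omega) (by omega)]
    split_ifs <;> omega
  by_cases h6 : t = 1 ∧ x % 4 = 3
  · rw [vc_odd c (by omega) (by omega), vc_odd d (by omega) (by omega)]
    unfold goodS; split_ifs <;> omega
  · rw [vc_one c (by omega) (by omega), vc_one d (by omega) (by omega)]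
    split_ifs <;> omega

set_option maxHeartbeats 4000000 in
theorem low_loop (n t m f L x : ℕ) (h : feas t m f L x) (hn : 6 ≤ n) (he : n % 2 = 0) :
    vS t m f (L+1) (x+n) ≤ ((n : ℤ) - 4) + |vS t m f L x - 4| := by
  obtain ⟨h1, h2, h3⟩ := h
  rw [← sub_le_iff_le_add']
  apply le_abs.mpr
  rcases Nat.eq_zero_or_pos (t + m + f + L) with h0 | h0
  · obtain ⟨rfl, rfl, rfl, rfl⟩ : t = 0 ∧ m = 0 ∧ f = 0 ∧ L = 0 := by omega
    obtain rfl : x = 0 := by omega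
    rw [vS_empty, vS_ne (by omega)]
    have hc : cS 0 0 0 (0+1) (0+n) = n := by simp [cS, tbS]
    rw [hc, vc, if_pos (by omega)]
    omega
  rw [vS_ne h0, vS_ne (by omega)]
  obtain ⟨c, hc⟩ : ∃ c, c = cS t m f L x := ⟨_, rfl⟩
  obtain ⟨d, hd⟩ : ∃ c, c = cS t m f (L+1) (x+n) := ⟨_, rfl⟩
  rw [← hc, ← hd]
  unfold cS at hc hd
  have k : (m = 0 ∧ f + L = 0 ∧ 0 < t ∧ d = c + n - 6 ∧ c = 4 - t ∧ (c - x) % 4 = 0) ∨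
     ((0 < m ∨ 0 < f + L) ∧ d = c + n - 8 ∧ ((c - x) % 4 = 0 ∨ (0 < t ∧ m = 0 ∧ (c-x)%4 = 2)) ∧
     -(t + 4*f+2*L : ℤ) + 4 ≤ c) := by
    rcases tbS_cases t m (f+L) with h | h | h | h | h <;>
    rcases tbS_cases t m (f+(L+1)) with h' | h' | h' | h' | h' <;> omega
  clear hc hd
  rcases Nat.lt_or_ge 6 n with hn' | hn'
  · have b1 := vc_bounds c t m f L x (by omega)
    have b2 := vc_bounds d t m f (L+1) (x+n) (by omega)
    have p1 := vc_parity c t m f L x (by omega)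
    have p2 := vc_parity d t m f (L+1) (x+n) (by omega)
    generalize vc c t m f L x = v at *
    by_cases hd2 : 2 ≤ d
    · rw [vc, if_pos hd2]
      omega
    · generalize vc d t m f (L+1) (x+n) = w at *
      omega
  obtain rfl : n = 6 := by omega
  have hx : x % 4 = 0 ∨ x % 4 = 1 ∨ x % 4 = 2 ∨ x % 4 = 3 := by omega
  have hx' : (x+6) % 4 = (x + 2) % 4 := by omega
  rcases Nat.lt_or_ge t 1 with ht | ht
  · rcases hx with hx | hx | hx | hx
    · rw [vc_zero c (by omega) hx, vc_two d (by omega) (by omega)]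
      unfold goodS; split_ifs <;> omega
    · rw [vc_odd c (by omega) (by omega), vc_odd d (by omega) (by omega)]
      unfold goodS; split_ifs <;> omega
    · rw [vc_two c (by omega) hx, vc_zero d (by omega) (by omega)]
      unfold goodS; split_ifs <;> omega
    · rw [vc_odd c (by omega) (by omega), vc_odd d (by omega) (by omega)]
      unfold goodS; split_ifs <;> omega
  rcases Nat.mod_two_eq_zero_or_one x with h5 | h5
  · rw [vc_even c (by omega) (by omega), vc_even d (by omega) (by omega)]
    split_ifs <;> omega
  by_cases h6 : t = 1 ∧ x % 4 = 3
  · rw [vc_odd c (by omega) (by omega), vc_one d (by omega) (by omega)]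
    unfold goodS; split_ifs <;> omega
  by_cases h7 : t = 1
  · rw [vc_one c (by omega) (by omega), vc_odd d (by omega) (by omega)]
    unfold goodS; split_ifs <;> omega
  · rw [vc_one c (by omega) (by omega), vc_one d (by omega) (by omega)]
    split_ifs <;> omega

set_option maxHeartbeats 4000000 in
theorem up_chain3 (t m f L x : ℕ) (h : feas t m f L x)
    (hf : (f = 0 ∧ ¬ (t = 0 ∧ m = 0 ∧ 2 ≤ cS (t+1) m f L (x+3) ∧ 0 < L)) ∨
      (¬ (cS (t+1) m f L (x+3) = 0) ∧ ¬ (cS (t+1) m f L (x+3) = -1 ∧ ¬ (m = 0 ∧ f = 1 ∧ L = 0)) ∧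
        ¬ (t = 0 ∧ ((x + 3) % 4 = 3 ∨ 1 ≤ cS (t+1) m f L (x+3))))) :
    1 + |vS t m f L x - 2| ≤ vS (t+1) m f L (x+3) := by
  obtain ⟨h1, h2, h3⟩ := h
  rw [← le_sub_iff_add_le']
  apply abs_le.mpr
  rcases Nat.eq_zero_or_pos (t + m + f + L) with h0 | h0
  · obtain ⟨rfl, rfl, rfl, rfl⟩ : t = 0 ∧ m = 0 ∧ f = 0 ∧ L = 0 := by omega
    obtain rfl : x = 0 := by omega
    decide
  rw [vS_ne h0, vS_ne (by omega)]
  obtain ⟨c, hc⟩ : ∃ c, c = cS t m f L x := ⟨_, rfl⟩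
  obtain ⟨d, hd⟩ : ∃ c, c = cS (t+1) m f L (x+3) := ⟨_, rfl⟩
  rw [← hc, ← hd]
  rw [← hd] at hf
  unfold cS at hc hd
  have k : (t = 0 ∧ m = 0 ∧ d = c - 3 ∧ (c - x) % 4 = 0) ∨ (d = c - 1 ∧ 
     ((c - x) % 4 = 0 ∨ (0 < t ∧ m = 0 ∧ (c-x)%4 = 2)) ∧ -(t + 4*f+2*L : ℤ) + 4 ≤ c ∧
     (m = 0 → 0 < t → 0 < f + L → c = x - 4 * t - 8 * (f + L) + 6)) := by
    rcases tbS_cases t m (f+L) with h | h | h | h | h <;> 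
    rcases tbS_cases (t+1) m (f+L) with h' | h' | h' | h' | h' <;> omega
  clear hc hd
  have hx : x % 4 = 0 ∨ x % 4 = 1 ∨ x % 4 = 2 ∨ x % 4 = 3 := by omega
  rcases Nat.lt_or_ge t 1 with ht | ht
  · rcases hx with hx | hx | hx | hx
    · rw [vc_zero c (by omega) hx, vc_odd d (by omega) (by omega)]
      unfold goodS; split_ifs <;> omega
    · rw [vc_odd c (by omega) (by omega), vc_even d (by omega) (by omega)]
      unfold goodS; split_ifs <;> omega
    · rw [vc_two c (by omega) hx, vc_one d (by omega) (by omega)]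
      split_ifs <;> omega
    · rw [vc_odd c (by omega) (by omega), vc_even d (by omega) (by omega)]
      unfold goodS; split_ifs <;> omega
  rcases Nat.mod_two_eq_zero_or_one x with h5 | h5
  · rw [vc_even c (by omega) (by omega), vc_one d (by omega) (by omega)]
    split_ifs <;> omega
  by_cases h6 : t = 1 ∧ x % 4 = 3
  · rw [vc_odd c (by omega) (by omega), vc_even d (by omega) (by omega)]
    unfold goodS; split_ifs <;> omega
  · rw [vc_one c (by omega) (by omega), vc_even d (by omega) (by omega)]
    split_ifs <;> omega

set_option maxHeartbeats 4000000 in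
theorem up_loop4 (t m f L x : ℕ) (h : feas t m f L x)
    (hf : t = 0 ∨ cS t m (f+1) L (x+4) = 0 ∨
      (cS t m (f+1) L (x+4) = -1 ∧ ¬ (m = 0 ∧ f = 0 ∧ L = 0)) ∨
      (t = 1 ∧ ((x + 4) % 4 = 3 ∨ 1 ≤ cS t m (f+1) L (x+4)))) :
    |vS t m f L x - 4| ≤ vS t m (f+1) L (x+4) := by
  obtain ⟨h1, h2, h3⟩ := h
  apply abs_le.mpr
  rcases Nat.eq_zero_or_pos (t + m + f + L) with h0 | h0
  · obtain ⟨rfl, rfl, rfl, rfl⟩ : t = 0 ∧ m = 0 ∧ f = 0 ∧ L = 0 := by omega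
    obtain rfl : x = 0 := by omega
    decide
  rw [vS_ne h0, vS_ne (by omega)]
  obtain ⟨c, hc⟩ : ∃ c, c = cS t m f L x := ⟨_, rfl⟩
  obtain ⟨d, hd⟩ : ∃ c, c = cS t m (f+1) L (x+4) := ⟨_, rfl⟩
  rw [← hc, ← hd]
  rw [← hd] at hf
  unfold cS at hc hd
  have k : (m = 0 ∧ f + L = 0 ∧ c = 4 - t ∧ d = 2 - t ∧ 0 < t) ∨ (d = c - 4 ∧ 
     ((c - x) % 4 = 0 ∨ (0 < t ∧ m = 0 ∧ (c-x)%4 = 2)) ∧ -(t + 4*f+2*L : ℤ) + 4 ≤ c ∧ (0 < m ∨ 0 < f + L)) := by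
    rcases tbS_cases t m (f+L) with h | h | h | h | h <;> 
    rcases tbS_cases t m (f+1+L) with h' | h' | h' | h' | h' <;> omega
  clear hc hd
  have hx : x % 4 = 0 ∨ x % 4 = 1 ∨ x % 4 = 2 ∨ x % 4 = 3 := by omega
  have hx' : (x+4) % 4 = x % 4 := by omega
  rcases Nat.lt_or_ge t 1 with ht | ht
  · rcases hx with hx | hx | hx | hx
    · rw [vc_zero c (by omega) hx, vc_zero d (by omega) (by omega)]
      unfold goodS; split_ifs <;> omega
    · rw [vc_odd c (by omega) (by omega), vc_odd d (by omega) (by omega)]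
      unfold goodS; split_ifs <;> omega
    · rw [vc_two c (by omega) hx, vc_two d (by omega) (by omega)]
      split_ifs <;> omega
    · rw [vc_odd c (by omega) (by omega), vc_odd d (by omega) (by omega)]
      unfold goodS; split_ifs <;> omega
  rcases Nat.mod_two_eq_zero_or_one x with h5 | h5
  · rw [vc_even c (by omega) (by omega), vc_even d (by omega) (by omega)]
    split_ifs <;> omega
  by_cases h6 : t = 1 ∧ x % 4 = 3
  · rw [vc_odd c (by omega) (by omega), vc_odd d (by omega) (by omega)]
    unfold goodS; split_ifs <;> omega
  · rw [vc_one c (by omega) (by omega), vc_one d (by omega) (by omega)]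
    split_ifs <;> omega

set_option maxHeartbeats 4000000 in
theorem up_chain (n m x : ℕ) (h : feas 0 m 0 0 x) (hn : 4 ≤ n) :
    ((n : ℤ) - 2) + |vS 0 m 0 0 x - 2| ≤ vS 0 (m+1) 0 0 (x+n) := by
  obtain ⟨h1, h2, h3⟩ := h
  rw [← le_sub_iff_add_le']
  apply abs_le.mpr
  rcases Nat.eq_zero_or_pos m with h0 | h0
  · subst h0
    obtain rfl : x = 0 := by omega
    rw [vS_empty, vS_ne (by omega)]
    have hc : cS 0 (0+1) 0 0 (0+n) = n := by simp [cS, tbS]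
    rw [hc, vc, if_pos (by omega)]
    omega
  rw [vS_ne (by omega), vS_ne (by omega)]
  obtain ⟨c, hc⟩ : ∃ c, c = cS 0 m 0 0 x := ⟨_, rfl⟩
  obtain ⟨d, hd⟩ : ∃ c, c = cS 0 (m+1) 0 0 (x+n) := ⟨_, rfl⟩
  rw [← hc, ← hd]
  unfold cS at hc hd
  have k : d = c + n - 4 ∧ 4 ≤ c := by
    rcases tbS_cases 0 m (0+0) with h | h | h | h | h <;>
    rcases tbS_cases 0 (m+1) (0+0) with h' | h' | h' | h' | h' <;> omega
  rw [vc, if_pos (by omega), vc, if_pos (by omega)]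
  omega

set_option maxHeartbeats 4000000 in
theorem up_loop8 (n t m L x : ℕ) (h : feas t m 0 L x) (hn : 8 ≤ n)
    (hx : 3 * t + 4 * m + 8 * L ≤ x)
    (ht : t = 0 ∨ (t = 1 ∧ m = 0 ∧ 2 ≤ cS t m 0 (L+1) (x+n))) :
    ((n : ℤ) - 4) + |vS t m 0 L x - 4| ≤ vS t m 0 (L+1) (x+n) := by
  obtain ⟨h1, h2, h3⟩ := h
  rw [← le_sub_iff_add_le']
  apply abs_le.mpr
  rcases Nat.eq_zero_or_pos (t + m + 0 + L) with h0 | h0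
  · obtain ⟨rfl, rfl, rfl⟩ : t = 0 ∧ m = 0 ∧ L = 0 := by omega
    obtain rfl : x = 0 := by omega
    rw [vS_empty, vS_ne (by omega)]
    have hc : cS 0 0 0 (0+1) (0+n) = n := by simp [cS, tbS]
    rw [hc, vc, if_pos (by omega)]
    omega
  rw [vS_ne (by omega), vS_ne (by omega)]
  obtain ⟨c, hc⟩ : ∃ c, c = cS t m 0 L x := ⟨_, rfl⟩
  obtain ⟨d, hd⟩ : ∃ c, c = cS t m 0 (L+1) (x+n) := ⟨_, rfl⟩
  rw [← hc, ← hd]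
  rw [← hd] at ht
  unfold cS at hc hd
  have k : (m = 0 ∧ L = 0 ∧ t = 1 ∧ d = c + n - 6 ∧ c = 3) ∨
      (d = c + n - 8 ∧ 4 ≤ c) := by
    rcases tbS_cases t m (0+L) with h | h | h | h | h <;>
    rcases tbS_cases t m (0+(L+1)) with h' | h' | h' | h' | h' <;> omega
  rw [vc, if_pos (by omega), vc, if_pos (by omega)]
  omega

set_option maxHeartbeats 4000000 in
theorem up_loop6 (t m f L x : ℕ) (h : feas t m f L x) (hf : f = 0)
    (hf' : t = 0 ∨ (t = 1 ∧ m = 0 ∧ 2 ≤ cS t m f (L+1) (x+6))) :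
    2 + |vS t m f L x - 4| ≤ vS t m f (L+1) (x+6) := by
  obtain ⟨h1, h2, h3⟩ := h
  rw [← le_sub_iff_add_le']
  apply abs_le.mpr
  rcases Nat.eq_zero_or_pos (t + m + f + L) with h0 | h0
  · obtain ⟨rfl, rfl, rfl, rfl⟩ : t = 0 ∧ m = 0 ∧ f = 0 ∧ L = 0 := by omega
    obtain rfl : x = 0 := by omega
    decide
  rw [vS_ne h0, vS_ne (by omega)]
  obtain ⟨c, hc⟩ : ∃ c, c = cS t m f L x := ⟨_, rfl⟩
  obtain ⟨d, hd⟩ : ∃ c, c = cS t m f (L+1) (x+6) := ⟨_, rfl⟩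
  rw [← hc, ← hd]
  rw [← hd] at hf'
  unfold cS at hc hd
  have k : (m = 0 ∧ f + L = 0 ∧ 0 < t ∧ d = c + 6 - 6 ∧ c = 4 - t ∧ (c - x) % 4 = 0) ∨
     ((0 < m ∨ 0 < f + L) ∧ d = c + 6 - 8 ∧ ((c - x) % 4 = 0 ∨ (0 < t ∧ m = 0 ∧ (c-x)%4 = 2)) ∧
     -(t + 4*f+2*L : ℤ) + 4 ≤ c) := by
    rcases tbS_cases t m (f+L) with h | h | h | h | h <;>
    rcases tbS_cases t m (f+(L+1)) with h' | h' | h' | h' | h' <;> omega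
  clear hc hd
  have hx : x % 4 = 0 ∨ x % 4 = 1 ∨ x % 4 = 2 ∨ x % 4 = 3 := by omega
  have hx' : (x+6) % 4 = (x + 2) % 4 := by omega
  rcases Nat.lt_or_ge t 1 with ht | ht
  · rcases hx with hx | hx | hx | hx
    · rw [vc_zero c (by omega) hx, vc_two d (by omega) (by omega)]
      unfold goodS; split_ifs <;> omega
    · rw [vc_odd c (by omega) (by omega), vc_odd d (by omega) (by omega)]
      unfold goodS; split_ifs <;> omega
    · rw [vc_two c (by omega) hx, vc_zero d (by omega) (by omega)]
      unfold goodS; split_ifs <;> omega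
    · rw [vc_odd c (by omega) (by omega), vc_odd d (by omega) (by omega)]
      unfold goodS; split_ifs <;> omega
  rcases Nat.mod_two_eq_zero_or_one x with h5 | h5
  · rw [vc_even c (by omega) (by omega), vc_even d (by omega) (by omega)]
    split_ifs <;> omega
  by_cases h6 : t = 1 ∧ x % 4 = 3
  · rw [vc_odd c (by omega) (by omega), vc_one d (by omega) (by omega)]
    unfold goodS; split_ifs <;> omega
  by_cases h7 : t = 1
  · rw [vc_one c (by omega) (by omega), vc_odd d (by omega) (by omega)]
    unfold goodS; split_ifs <;> omega
  · rw [vc_one c (by omega) (by omega), vc_one d (by omega) (by omega)]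
    split_ifs <;> omega

/-- Number of chains other than 3-chains. -/
def mS (G : Position) : ℕ := G.countP (fun C => C.isChain = true ∧ C ≠ Component.chain 3)

/-- Number of loops other than 4-loops. -/
def LS (G : Position) : ℕ := G.countP (fun C => C.isLoop = true ∧ C ≠ Component.loop 4)

/-- The closed formula evaluated at a position. -/
def sv (G : Position) : ℤ := vS (theta G) (mS G) (numF G) (LS G) (size G)

theorem size_cons (C : Component) (G : Position) : size (C ::ₘ G) = size G + C.size := by
  simp [size, add_comm]

theorem mS_cons (C : Component) (G : Position) : mS (C ::ₘ G) =
    mS G + if C.isChain = true ∧ C ≠ Component.chain 3 then 1 else 0 :=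
  Multiset.countP_cons _ _ _

theorem LS_cons (C : Component) (G : Position) : LS (C ::ₘ G) =
    LS G + if C.isLoop = true ∧ C ≠ Component.loop 4 then 1 else 0 :=
  Multiset.countP_cons _ _ _

theorem numChains_cons (C : Component) (G : Position) : numChains (C ::ₘ G) =
    numChains G + if C.isChain = true then 1 else 0 := by
  unfold numChains
  rw [Multiset.filter_cons]
  split_ifs <;> simp [add_comm]

theorem numLoops_cons (C : Component) (G : Position) : numLoops (C ::ₘ G) =
    numLoops G + if C.isLoop = true then 1 else 0 := by
  unfold numLoops
  rw [Multiset.filter_cons]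
  split_ifs <;> simp [add_comm]

theorem stats_chain3 (G : Position) :
    theta (Component.chain 3 ::ₘ G) = theta G + 1 ∧ mS (Component.chain 3 ::ₘ G) = mS G ∧
    numF (Component.chain 3 ::ₘ G) = numF G ∧ LS (Component.chain 3 ::ₘ G) = LS G ∧
    size (Component.chain 3 ::ₘ G) = size G + 3 := by
  refine ⟨?_, ?_, ?_, ?_, ?_⟩ <;>
  simp [theta, mS_cons, numF, LS_cons, size_cons, Component.isChain, Component.isLoop,
    Component.size, Multiset.count_cons]

theorem stats_chain (n : ℕ) (hn : n ≠ 3) (G : Position) :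
    theta (Component.chain n ::ₘ G) = theta G ∧ mS (Component.chain n ::ₘ G) = mS G + 1 ∧
    numF (Component.chain n ::ₘ G) = numF G ∧ LS (Component.chain n ::ₘ G) = LS G ∧
    size (Component.chain n ::ₘ G) = size G + n := by
  have hn' : 3 ≠ n := hn.symm
  refine ⟨?_, ?_, ?_, ?_, ?_⟩ <;>
  simp [theta, mS_cons, numF, LS_cons, size_cons, Component.isChain, Component.isLoop,
    Component.size, Multiset.count_cons, hn, hn']

theorem stats_loop4 (G : Position) :
    theta (Component.loop 4 ::ₘ G) = theta G ∧ mS (Component.loop 4 ::ₘ G) = mS G ∧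
    numF (Component.loop 4 ::ₘ G) = numF G + 1 ∧ LS (Component.loop 4 ::ₘ G) = LS G ∧
    size (Component.loop 4 ::ₘ G) = size G + 4 := by
  refine ⟨?_, ?_, ?_, ?_, ?_⟩ <;>
  simp [theta, mS_cons, numF, LS_cons, size_cons, Component.isChain, Component.isLoop,
    Component.size, Multiset.count_cons]

theorem stats_loop (n : ℕ) (hn : n ≠ 4) (G : Position) :
    theta (Component.loop n ::ₘ G) = theta G ∧ mS (Component.loop n ::ₘ G) = mS G ∧
    numF (Component.loop n ::ₘ G) = numF G ∧ LS (Component.loop n ::ₘ G) = LS G + 1 ∧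
    size (Component.loop n ::ₘ G) = size G + n := by
  have hn' : 4 ≠ n := hn.symm
  refine ⟨?_, ?_, ?_, ?_, ?_⟩ <;>
  simp [theta, mS_cons, numF, LS_cons, size_cons, Component.isChain, Component.isLoop,
    Component.size, Multiset.count_cons, hn, hn']

/-- Case analysis on the kinds of components. -/
theorem valid_cases {C : Component} (h : C.Valid) :
    C = Component.chain 3 ∨ (∃ n, 4 ≤ n ∧ C = Component.chain n) ∨ C = Component.loop 4 ∨
    (∃ n, 6 ≤ n ∧ n % 2 = 0 ∧ C = Component.loop n) := by
  cases C with
  | chain n =>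
    have h : 3 ≤ n := h
    rcases Nat.lt_or_ge 3 n with h' | h'
    · exact Or.inr (Or.inl ⟨n, h', rfl⟩)
    · obtain rfl : n = 3 := by omega
      exact Or.inl rfl
  | loop n =>
    have h : 4 ≤ n ∧ Even n := h
    have h2 := Nat.even_iff.mp h.2
    by_cases h' : n = 4
    · subst h'; simp
    · exact Or.inr (Or.inr (Or.inr ⟨n, by omega, h2, rfl⟩))

theorem feas_of_valid (G : Position) (hG : G.Valid) :
    feas (theta G) (mS G) (numF G) (LS G) (size G) := by
  induction G using Multiset.induction_on with
  | empty => simp [feas, theta, mS, numF, LS, size]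
  | cons C G ih =>
    have hG' : Position.Valid G := fun D hD => hG D (Multiset.mem_cons_of_mem hD)
    obtain ⟨h1, h2, h3⟩ := ih hG'
    rcases valid_cases (hG C (Multiset.mem_cons_self C G)) with
      rfl | ⟨n, hn, rfl⟩ | rfl | ⟨n, hn, hn2, rfl⟩
    · obtain ⟨a, b, c, d, e⟩ := stats_chain3 G
      rw [a, b, c, d, e]; unfold feas; omega
    · obtain ⟨a, b, c, d, e⟩ := stats_chain n (by omega) G
      rw [a, b, c, d, e]; unfold feas; omega
    · obtain ⟨a, b, c, d, e⟩ := stats_loop4 G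
      rw [a, b, c, d, e]; unfold feas; omega
    · obtain ⟨a, b, c, d, e⟩ := stats_loop n (by omega) G
      rw [a, b, c, d, e]; unfold feas; omega

theorem feas8_of_valid (G : Position) (hG : G.Valid) (h6 : Component.loop 6 ∉ G) :
    3 * theta G + 4 * mS G + 4 * numF G + 8 * LS G ≤ size G := by
  induction G using Multiset.induction_on with
  | empty => simp [theta, mS, numF, LS, size]
  | cons C G ih =>
    have hG' : Position.Valid G := fun D hD => hG D (Multiset.mem_cons_of_mem hD)
    have h1 := ih hG' (fun h => h6 (Multiset.mem_cons_of_mem h))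
    rcases valid_cases (hG C (Multiset.mem_cons_self C G)) with
      rfl | ⟨n, hn, rfl⟩ | rfl | ⟨n, hn, hn2, rfl⟩
    · obtain ⟨a, b, c, d, e⟩ := stats_chain3 G
      rw [a, b, c, d, e]; omega
    · obtain ⟨a, b, c, d, e⟩ := stats_chain n (by omega) G
      rw [a, b, c, d, e]; omega
    · obtain ⟨a, b, c, d, e⟩ := stats_loop4 G
      rw [a, b, c, d, e]; omega
    · obtain ⟨a, b, c, d, e⟩ := stats_loop n (by omega) G
      have : n ≠ 6 := by
        rintro rfl
        exact h6 (Multiset.mem_cons_self _ _)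
      rw [a, b, c, d, e]; omega

theorem sv_low (C : Component) (G : Position) (hC : C.Valid) (hG : G.Valid) :
    sv (C ::ₘ G) ≤ openVal C (sv G) := by
  have hf := feas_of_valid G hG
  unfold sv openVal
  rcases valid_cases hC with rfl | ⟨n, hn, rfl⟩ | rfl | ⟨n, hn, hn2, rfl⟩
  · obtain ⟨a, b, c, d, e⟩ := stats_chain3 G
    rw [a, b, c, d, e]
    simpa using low_chain3 _ _ _ _ _ hf
  · obtain ⟨a, b, c, d, e⟩ := stats_chain n (by omega) G
    rw [a, b, c, d, e]
    exact low_chain n _ _ _ _ _ hf hn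
  · obtain ⟨a, b, c, d, e⟩ := stats_loop4 G
    rw [a, b, c, d, e]
    simpa using low_loop4 _ _ _ _ _ hf
  · obtain ⟨a, b, c, d, e⟩ := stats_loop n (by omega) G
    rw [a, b, c, d, e]
    exact low_loop n _ _ _ _ _ hf hn hn2

theorem stats_pos (G : Position) (hG : G.Valid) (hne : G ≠ 0) :
    0 < theta G + mS G + numF G + LS G := by
  obtain ⟨C, hC⟩ := Multiset.exists_mem_of_ne_zero hne
  obtain ⟨H, rfl⟩ := Multiset.exists_cons_of_mem hC
  rcases valid_cases (hG C (Multiset.mem_cons_self C H)) with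
      rfl | ⟨n, hn, rfl⟩ | rfl | ⟨n, hn, hn2, rfl⟩
  · have := stats_chain3 H; omega
  · have := stats_chain n (by omega) H; omega
  · have := stats_loop4 H; omega
  · have := stats_loop n (by omega) H; omega

theorem sv_up (G : Position) (hG : G.Valid) (hne : G ≠ 0) :
    ∃ C H, G = C ::ₘ H ∧ openVal C (sv H) ≤ sv G := by
  have hpos := stats_pos G hG hne
  have hsub : ∀ C H, G = C ::ₘ H → Position.Valid H := fun C H h D hD =>
    hG D (h ▸ Multiset.mem_cons_of_mem hD)
  obtain ⟨d, hd⟩ : ∃ d, d = cS (theta G) (mS G) (numF G) (LS G) (size G) := ⟨_, rfl⟩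
  by_cases hA : 0 < numF G ∧ (theta G = 0 ∨ d = 0 ∨
      (d = -1 ∧ ¬ (mS G = 0 ∧ numF G = 1 ∧ LS G = 0)) ∨
      (theta G = 1 ∧ (size G % 4 = 3 ∨ 1 ≤ d)))
  · obtain ⟨h1, h2⟩ := hA
    obtain ⟨H, hH⟩ := Multiset.exists_cons_of_mem (Multiset.count_pos.mp h1)
    refine ⟨_, H, hH, ?_⟩
    have hf := feas_of_valid H (hsub _ _ hH)
    subst hH
    obtain ⟨a, b, c, a4, e⟩ := stats_loop4 H
    unfold sv openVal
    rw [a, b, c, a4, e] at hd ⊢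
    have := up_loop4 _ _ _ _ _ hf (by rw [← hd]; omega)
    simpa using this
  by_cases hB : 0 < theta G ∧ ((numF G = 0 ∧ ¬ (theta G = 1 ∧ mS G = 0 ∧ 2 ≤ d ∧ 0 < LS G)) ∨
      (¬ (d = 0) ∧ ¬ (d = -1 ∧ ¬ (mS G = 0 ∧ numF G = 1 ∧ LS G = 0)) ∧
        ¬ (theta G = 1 ∧ (size G % 4 = 3 ∨ 1 ≤ d))))
  · obtain ⟨h1, h2⟩ := hB
    obtain ⟨H, hH⟩ := Multiset.exists_cons_of_mem (Multiset.count_pos.mp h1)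
    refine ⟨_, H, hH, ?_⟩
    have hf := feas_of_valid H (hsub _ _ hH)
    subst hH
    obtain ⟨a, b, c, a4, e⟩ := stats_chain3 H
    unfold sv openVal
    rw [a, b, c, a4, e] at hd ⊢
    have := up_chain3 _ _ _ _ _ hf (by rw [← hd]; omega)
    simpa using this
  have hC : numF G = 0 ∧ (theta G = 0 ∨ (theta G = 1 ∧ mS G = 0 ∧ 2 ≤ d ∧ 0 < LS G)) := by omega
  clear hA hB
  obtain ⟨hf0, ht⟩ := hC
  rcases Nat.eq_zero_or_pos (LS G) with hL | hL
  · have hm : 0 < mS G := by omega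
    obtain ⟨C, hCG, hC1, hC2⟩ := Multiset.countP_pos.mp hm
    obtain ⟨H, hH⟩ := Multiset.exists_cons_of_mem hCG
    refine ⟨_, H, hH, ?_⟩
    have hf := feas_of_valid H (hsub _ _ hH)
    rcases valid_cases (hG C hCG) with rfl | ⟨n, hn, rfl⟩ | rfl | ⟨n, hn, hn2, rfl⟩
    · exact absurd rfl hC2
    · subst hH
      obtain ⟨a, b, c, a4, e⟩ := stats_chain n (by omega) H
      unfold sv openVal
      rw [a, b, c, a4, e] at hd ⊢
      have e1 : theta H = 0 := by omega
      have e2 : numF H = 0 := by omega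
      have e3 : LS H = 0 := by omega
      rw [e1, e2, e3] at hf ⊢
      exact up_chain n _ _ hf hn
    · simp [Component.isChain] at hC1
    · simp [Component.isChain] at hC1
  by_cases h6 : Component.loop 6 ∈ G
  · obtain ⟨H, hH⟩ := Multiset.exists_cons_of_mem h6
    refine ⟨_, H, hH, ?_⟩
    have hf := feas_of_valid H (hsub _ _ hH)
    subst hH
    obtain ⟨a, b, c, a4, e⟩ := stats_loop 6 (by omega) H
    unfold sv openVal
    rw [a, b, c, a4, e] at hd ⊢
    have := up_loop6 _ _ _ _ _ hf (by omega) (by rw [← hd]; omega)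
    norm_num
    exact this
  · obtain ⟨C, hCG, hC1, hC2⟩ := Multiset.countP_pos.mp hL
    obtain ⟨H, hH⟩ := Multiset.exists_cons_of_mem hCG
    refine ⟨_, H, hH, ?_⟩
    have hf := feas_of_valid H (hsub _ _ hH)
    have hf8 := feas8_of_valid H (hsub _ _ hH)
      (fun h => h6 (hH ▸ Multiset.mem_cons_of_mem h))
    rcases valid_cases (hG C hCG) with rfl | ⟨n, hn, rfl⟩ | rfl | ⟨n, hn, hn2, rfl⟩
    · simp [Component.isLoop] at hC1
    · simp [Component.isLoop] at hC1
    · exact absurd rfl hC2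
    · have hn6 : n ≠ 6 := by
        rintro rfl
        exact h6 hCG
      subst hH
      obtain ⟨a, b, c, a4, e⟩ := stats_loop n (by omega) H
      unfold sv openVal
      rw [a, b, c, a4, e] at hd ⊢
      have e2 : numF H = 0 := by omega
      rw [e2] at hf hd hf8 ⊢
      exact up_loop8 n _ _ _ _ hf (by omega) (by omega) (by rw [← hd]; omega)

theorem value_rec (G : Position) (hne : G ≠ 0) :
    value G = sInf { x : ℤ | ∃ C ∈ G, x = openVal C (value (G.erase C)) } := by
  obtain ⟨C, hC⟩ := Multiset.exists_mem_of_ne_zero hne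
  obtain ⟨k, hk⟩ : ∃ k, Multiset.card G = k + 1 :=
    ⟨Multiset.card G - 1, by have := Multiset.card_pos.mpr hne; omega⟩
  unfold value
  rw [hk, valueAux, if_neg hne]
  congr 1
  ext x
  refine exists_congr fun D => and_congr_right fun hD => ?_
  rw [Multiset.card_erase_of_mem hD, hk]
  simp

theorem value_eq_sv (k : ℕ) : ∀ G : Position, Multiset.card G = k → G.Valid → value G = sv G := by
  induction k with
  | zero =>
    intro G hk _
    obtain rfl := Multiset.card_eq_zero.mp hk
    simp [value, valueAux, sv, theta, mS, numF, LS, vS]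
  | succ k ih =>
    intro G hk hG
    have hne : G ≠ 0 := by
      rintro rfl
      simp at hk
    rw [value_rec G hne]
    apply IsLeast.csInf_eq
    have hle : ∀ C ∈ G, value (G.erase C) = sv (G.erase C) := fun C hC =>
      ih _ (by rw [Multiset.card_erase_of_mem hC, hk]; rfl)
        (fun D hD => hG D (Multiset.mem_of_mem_erase hD))
    have hlow : ∀ C ∈ G, sv G ≤ openVal C (value (G.erase C)) := fun C hC => by
      rw [hle C hC]
      have := sv_low C (G.erase C) (hG C hC) (fun D hD => hG D (Multiset.mem_of_mem_erase hD))
      rwa [Multiset.cons_erase hC] at this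
    constructor
    · obtain ⟨C, H, hH, hv⟩ := sv_up G hG hne
      have hC : C ∈ G := hH ▸ Multiset.mem_cons_self C H
      refine ⟨C, hC, le_antisymm (hlow C hC) ?_⟩
      rw [hle C hC]
      have : G.erase C = H := by rw [hH, Multiset.erase_cons_head]
      rwa [this]
    · rintro x ⟨C, hC, rfl⟩
      exact hlow C hC

theorem numChains_eq (G : Position) (hG : G.Valid) :
    numChains G = theta G + mS G ∧ numLoops G = numF G + LS G := by
  induction G using Multiset.induction_on with
  | empty => simp [numChains, numLoops, theta, mS, numF, LS]
  | cons C G ih =>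
    have hG' : Position.Valid G := fun D hD => hG D (Multiset.mem_cons_of_mem hD)
    obtain ⟨h1, h2⟩ := ih hG'
    rw [numChains_cons, numLoops_cons]
    rcases valid_cases (hG C (Multiset.mem_cons_self C G)) with
      rfl | ⟨n, hn, rfl⟩ | rfl | ⟨n, hn, hn2, rfl⟩
    · obtain ⟨a, b, c, d, e⟩ := stats_chain3 G
      rw [a, b, c, d]; simp [Component.isChain, Component.isLoop]; omega
    · obtain ⟨a, b, c, d, e⟩ := stats_chain n (by omega) G
      rw [a, b, c, d]; simp [Component.isChain, Component.isLoop]; omega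
    · obtain ⟨a, b, c, d, e⟩ := stats_loop4 G
      rw [a, b, c, d]; simp [Component.isChain, Component.isLoop]; omega
    · obtain ⟨a, b, c, d, e⟩ := stats_loop n (by omega) G
      rw [a, b, c, d]; simp [Component.isChain, Component.isLoop]; omega

theorem tb_eq (G : Position) (hG : G.Valid) (hne : G ≠ 0) :
    tb G = tbS (theta G) (mS G) (numF G + LS G) := by
  have hp := stats_pos G hG hne
  have hn := (numChains_eq G hG)
  have e1 : (∀ C ∈ G, C.isLoop = true) ↔ (theta G = 0 ∧ mS G = 0) := by
    have : numChains G = 0 ↔ ∀ C ∈ G, C.isLoop = true := by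
      unfold numChains
      rw [Multiset.card_eq_zero, Multiset.filter_eq_nil]
      refine forall₂_congr fun C _ => ?_
      cases C <;> simp [Component.isChain, Component.isLoop]
    rw [← this]; omega
  have e2 : (∃ C ∈ G, C.isLoop = true) ↔ (numF G + LS G ≠ 0) := by
    rw [← hn.2]
    unfold numLoops
    rw [Ne, Multiset.card_eq_zero, Multiset.filter_eq_nil]
    push Not
    rfl
  have e3 : Component.chain 3 ∈ G ↔ theta G ≠ 0 := by
    unfold theta
    rw [← Multiset.count_pos]; omega
  have e4 : (∀ C ∈ G, C.isChain = true → C = Component.chain 3) ↔ mS G = 0 := by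
    unfold mS
    rw [Multiset.countP_eq_zero]
    refine forall₂_congr fun C _ => ?_
    tauto
  unfold tb tbS
  rw [if_neg hne]
  simp only [e1, e2, e3, e4]
  split_ifs <;> omega

theorem cval_eq (G : Position) (hG : G.Valid) (hne : G ≠ 0) :
    cval G = cS (theta G) (mS G) (numF G) (LS G) (size G) := by
  have hn := (numChains_eq G hG)
  unfold cval cS
  rw [tb_eq G hG hne, hn.1, hn.2]
  push_cast
  ring

/-- Values greater than 2: v(G) > 2 iff c(G) > 2, or (i) and (ii) both hold. -/
theorem values_gt_two (G : Position) (hG : G.Valid) (hne : G ≠ 0) :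
    2 < value G ↔
      (2 < cval G ∨
        (((theta G = 1 ∧ size G % 4 = 3) ∨ (theta G = 0 ∧ size G % 4 ≠ 2)) ∧
          ((2 < cval G + 4 * (numF G : ℤ) ∧
              (cval G % 8 = 3 ∨ cval G % 8 = 5 ∨ cval G % 8 = 4)) ∨
            (cval G + 4 * (numF G : ℤ) < 2 ∧ Even (numF G))))) := by
  have hp := stats_pos G hG hne
  have hf := feas_of_valid G hG
  rw [value_eq_sv _ G rfl hG, Nat.even_iff, cval_eq G hG hne]
  unfold sv
  rw [vS_ne hp]
  change _ ↔ (_ ∨ (_ ∧ goodS _ _))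
  obtain ⟨d, hd⟩ : ∃ d, d = cS (theta G) (mS G) (numF G) (LS G) (size G) := ⟨_, rfl⟩
  rw [← hd]
  unfold cS at hd
  obtain ⟨h1, h2, h3⟩ := hf
  have k : (d - size G) % 4 = 0 ∨ (0 < theta G ∧ mS G = 0 ∧ (d - size G) % 4 = 2) := by
    rcases tbS_cases (theta G) (mS G) (numF G + LS G) with h | h | h | h | h <;> omega
  clear hd h1 h3 hne hG
  generalize theta G = t at *
  generalize mS G = m at *
  generalize numF G = f at *
  generalize LS G = L at *
  generalize size G = x at *
  unfold vc
  by_cases hg : goodS d f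
  · simp only [hg, if_true, and_true]
    unfold goodS at hg
    split_ifs <;> omega
  · simp only [hg, if_false, and_false, or_false]
    split_ifs <;> omega

end DotsAndBoxes
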